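/- arXiv:2509.21785 — 3 statements merged into one kernel-verified Lean document; each statement's English description precedes it below -/
import Mathlib

section
/- (Characterization of unbiased binnings.) A k-binning 0 = b_0 < b_1 < ⋯ < b_k = n is unbiased if and only if every interior boundary is a boundary candidate, i.e. for every 1 ≤ j ≤ k−1 one has r_{b_j} = r_n. -/
/-- Number of blue tuples among the first `i` tuples (tuples are indexed `1,…,n`,
`g j = true` means tuple `j` is blue). -/
def blueCount (g : ℕ → Bool) (i : ℕ) : ℕ :=
  ((Finset.Icc 1 i).filter (fun j => g j = true)).card

theorem blueCount_zero (g : ℕ → Bool) : blueCount g 0 = 0 := by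
  simp [blueCount]

/-- Characterization of unbiased binnings: a `k`-binning
`0 = b 0 < b 1 < ⋯ < b k = n` is unbiased (every bucket's blue ratio equals the
overall blue ratio) if and only if every interior boundary `b j` (`1 ≤ j ≤ k−1`)
is a boundary candidate, i.e. its prefix blue ratio equals the overall ratio. -/
theorem unbiased_binning_iff_boundary_candidates
    (n k : ℕ) (g : ℕ → Bool) (b : ℕ → ℕ)
    (hk : 1 ≤ k)
    (hb0 : b 0 = 0) (hbk : b k = n)
    (hmono : ∀ j < k, b j < b (j + 1)) :
    (∀ j, 1 ≤ j → j ≤ k →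
        ((blueCount g (b j) : ℚ) - (blueCount g (b (j - 1)) : ℚ))
            / ((b j : ℚ) - (b (j - 1) : ℚ))
          = (blueCount g n : ℚ) / n)
    ↔ (∀ j, 1 ≤ j → j < k →
        (blueCount g (b j) : ℚ) / (b j) = (blueCount g n : ℚ) / n) := by
  have hpos : ∀ j, 1 ≤ j → j ≤ k → (0 : ℚ) < b j := by
    intro j hj hjk
    have := hmono (j - 1) (by omega)
    rw [Nat.sub_add_cancel hj] at this
    exact_mod_cast (Nat.zero_le _).trans_lt this
  have hn : (n : ℚ) ≠ 0 := hbk ▸ (hpos k hk le_rfl).ne'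
  have hstep : ∀ j < k, (b (j + 1) : ℚ) - b j ≠ 0 := by
    intro j hj
    exact (sub_pos.2 (by exact_mod_cast hmono j hj)).ne'
  constructor
  · intro h
    have key : ∀ j ≤ k, (blueCount g (b j) : ℚ) = blueCount g n / n * b j := by
      intro j
      induction j with
      | zero => simp [hb0, blueCount_zero]
      | succ j ih =>
        intro hj
        have hbucket := h (j + 1) (by omega) hj
        rw [Nat.add_sub_cancel, div_eq_iff (hstep j hj)] at hbucket
        linear_combination hbucket + ih (by omega)
    intro j hj hjk
    rw [div_eq_iff (hpos j hj hjk.le).ne', key j hjk.le]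
  · intro h
    have key : ∀ j ≤ k, (blueCount g (b j) : ℚ) = blueCount g n / n * b j := by
      intro j hjk
      rcases Nat.eq_zero_or_pos j with rfl | hj
      · simp [hb0, blueCount_zero]
      rcases hjk.eq_or_lt with rfl | hlt
      · rw [hbk, div_mul_cancel₀ _ hn]
      · exact (div_eq_iff (hpos j hj hjk).ne').1 (h j hj hlt)
    intro j hj hjk
    obtain ⟨i, rfl⟩ := Nat.exists_eq_add_of_le' hj
    rw [Nat.add_sub_cancel, div_eq_iff (hstep i hjk), key _ hjk, key i (by omega)]
    ring
end

section
/- For n ≥ k ≥ 1, an unbiased k-binning of the n tuples exists if and only if there are at least k − 1 boundary candidates strictly smaller than n, i.e. |{i ∈ {1,…,n−1} : r_i = r_n}| ≥ k − 1. -/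
/-- If all increments of `f` along `b` have ratio `r`, then `f` is `r` times the identity
along `b`. -/
theorem eq_mul_of_increment_ratio_eq {f : ℕ → ℕ} {b : ℕ → ℕ} {k : ℕ} {r : ℚ}
    (hf : f 0 = 0) (hb0 : b 0 = 0) (hlt : ∀ j < k, b j < b (j + 1))
    (hr : ∀ j < k, ((f (b (j + 1)) : ℚ) - f (b j)) / ((b (j + 1) : ℚ) - b j) = r) :
    ∀ j ≤ k, (f (b j) : ℚ) = r * b j := by
  intro j
  induction j with
  | zero => simp [hb0, hf]
  | succ j ih =>
    intro hj
    have hpos : (0 : ℚ) < (b (j + 1) : ℚ) - b j :=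
      sub_pos.2 (Nat.cast_lt.2 (hlt j hj))
    have h := (div_eq_iff hpos.ne').1 (hr j hj)
    linarith [ih (by omega)]

/-- A finite set of natural numbers with minimum `0` and maximum `n` and `k + 1` elements
is listed increasingly by a sequence running from `0` to `n` in `k` steps. -/
theorem Finset.exists_increasing_enumeration {T : Finset ℕ} {n k : ℕ}
    (hcard : T.card = k + 1) (h0 : 0 ∈ T) (hn : n ∈ T) (hle : ∀ i ∈ T, i ≤ n) :
    ∃ b : ℕ → ℕ, b 0 = 0 ∧ b k = n ∧ (∀ j < k, b j < b (j + 1)) ∧ ∀ j ≤ k, b j ∈ T := by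
  set e := T.orderEmbOfFin hcard
  have hrange : ∀ i ∈ T, ∃ j, e j = i := fun i hi => by
    have : i ∈ Set.range e := by rw [T.range_orderEmbOfFin hcard]; exact hi
    exact this
  have hmem : ∀ j, e j ∈ T := T.orderEmbOfFin_mem hcard
  refine ⟨fun j => if h : j < k + 1 then e ⟨j, h⟩ else 0, ?_, ?_, ?_, ?_⟩
  · obtain ⟨j, hj⟩ := hrange 0 h0
    have : e 0 ≤ e j := e.monotone (Fin.zero_le j)
    rw [hj] at this
    simpa using Nat.le_zero.1 this
  · obtain ⟨j, hj⟩ := hrange n hn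
    have : e j ≤ e (Fin.last k) := e.monotone (Fin.le_last j)
    rw [hj] at this
    simpa [Fin.last] using le_antisymm (hle _ (hmem (Fin.last k))) this
  · intro j hj
    simp only [dif_pos (show j < k + 1 by omega), dif_pos (show j + 1 < k + 1 by omega)]
    exact e.strictMono (Fin.mk_lt_mk.2 (Nat.lt_succ_self j))
  · intro j hj
    simp only [dif_pos (show j < k + 1 by omega)]
    exact hmem _

/-- For `n ≥ k ≥ 1`, an unbiased `k`-binning of the `n` tuples exists if and only
if there are at least `k − 1` boundary candidates strictly smaller than `n`. -/
theorem unbiased_binning_exists_iff_enough_candidates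
    (n k : ℕ) (g : ℕ → Bool) (hk : 1 ≤ k) (hkn : k ≤ n) :
    (∃ b : ℕ → ℕ, b 0 = 0 ∧ b k = n ∧ (∀ j < k, b j < b (j + 1)) ∧
        ∀ j, 1 ≤ j → j ≤ k →
          ((blueCount g (b j) : ℚ) - (blueCount g (b (j - 1)) : ℚ))
              / ((b j : ℚ) - (b (j - 1) : ℚ))
            = (blueCount g n : ℚ) / n)
    ↔ k - 1 ≤ ((Finset.Icc 1 (n - 1)).filter
        (fun i => (blueCount g i : ℚ) / i = (blueCount g n : ℚ) / n)).card := by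
  have hn : (n : ℚ) ≠ 0 := Nat.cast_ne_zero.2 (by omega)
  constructor
  · rintro ⟨b, hb0, hbk, hlt, hr⟩
    have hlin := eq_mul_of_increment_ratio_eq (blueCount_zero g) hb0 hlt
      fun j hj => by simpa using hr (j + 1) (by omega) hj
    have hmono : StrictMonoOn b (Set.Icc 0 k) :=
      strictMonoOn_of_lt_succ Set.ordConnected_Icc fun j _ _ hj =>
        hlt j (Nat.lt_of_succ_le hj.2)
    have hcard : (Finset.Icc 1 (k - 1)).card = k - 1 := by simp
    rw [← hcard]
    refine Finset.card_le_card_of_injOn b ?_ (hmono.injOn.mono ?_)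
    · intro j hj
      have hj' := Finset.mem_Icc.1 hj
      have hpos : b 0 < b j := hmono ⟨le_rfl, by omega⟩ ⟨by omega, by omega⟩ (by omega)
      have hltn : b j < b k := hmono ⟨by omega, by omega⟩ ⟨by omega, le_rfl⟩ (by omega)
      refine Finset.mem_filter.2 ⟨Finset.mem_Icc.2 ⟨by omega, by omega⟩, ?_⟩
      exact (div_eq_iff (Nat.cast_ne_zero.2 (by omega))).2 (hlin j (by omega))
    · intro j hj
      have hj' := Finset.mem_Icc.1 hj
      exact ⟨by omega, by omega⟩
  · intro h
    obtain ⟨S, hS, hcard⟩ := Finset.exists_subset_card_eq h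
    have hmem : ∀ i ∈ S, (1 ≤ i ∧ i ≤ n - 1) ∧
        (blueCount g i : ℚ) / i = (blueCount g n : ℚ) / n := fun i hi => by
      simpa using hS hi
    have hnS : n ∉ S := fun hi => by have := (hmem n hi).1; omega
    have h0S : 0 ∉ insert n S := fun hi => by
      rcases Finset.mem_insert.1 hi with hi | hi
      · omega
      · have := (hmem 0 hi).1; omega
    have hlin : ∀ i ∈ insert 0 (insert n S),
        (blueCount g i : ℚ) = (blueCount g n : ℚ) / n * i := by
      intro i hi
      rcases Finset.mem_insert.1 hi with rfl | hi
      · simp [blueCount_zero]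
      rcases Finset.mem_insert.1 hi with rfl | hi
      · exact (div_mul_cancel₀ _ hn).symm
      have hi' := hmem i hi
      exact (div_eq_iff (Nat.cast_ne_zero.2 (by omega))).1 hi'.2
    obtain ⟨b, hb0, hbk, hlt, hbT⟩ :=
      Finset.exists_increasing_enumeration (T := insert 0 (insert n S)) (n := n) (k := k)
        (by rw [Finset.card_insert_of_notMem h0S, Finset.card_insert_of_notMem hnS]; omega)
        (by simp) (by simp) fun i hi => by
          rcases Finset.mem_insert.1 hi with rfl | hi
          · omega
          rcases Finset.mem_insert.1 hi with rfl | hi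
          · exact le_rfl
          have := (hmem i hi).1
          omega
    refine ⟨b, hb0, hbk, hlt, fun j hj1 hjk => ?_⟩
    have hstep : b (j - 1) < b j := by
      simpa [Nat.sub_add_cancel hj1] using hlt (j - 1) (by omega)
    have hpos : (0 : ℚ) < (b j : ℚ) - b (j - 1) := sub_pos.2 (Nat.cast_lt.2 hstep)
    rw [hlin _ (hbT j hjk), hlin _ (hbT (j - 1) (by omega)), ← mul_sub,
      mul_div_cancel_right₀ _ hpos.ne']
end

section
/- (Correctness of the divide-and-conquer split.) Let 0 ≤ l < h ≤ n, κ ≥ 2, and ε ≥ 0. Suppose there exists an ε-biased κ-binning of the range (l, h], i.e. boundaries l = i_0 < i_1 < ⋯ < i_κ = h such that every bucket (i_{j−1}, i_j] is ε-biased. Then there exists a split index i with l < i < h such that: the super bucket (l, i] is ε-biased, the super bucket (i, h] is ε-biased, the range (l, i] admits an ε-biased ⌈κ/2⌉-binning, and the range (i, h] admits an ε-biased ⌊κ/2⌋-binning. -/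
/-- The bucket `(i, j]` is ε-biased: its blue ratio deviates from the overall
blue ratio `r_n = c(n)/n` by at most `ε`. -/
def epsBiasedBucket (g : ℕ → Bool) (n : ℕ) (ε : ℚ) (i j : ℕ) : Prop :=
  |((blueCount g j : ℚ) - (blueCount g i : ℚ)) / ((j : ℚ) - (i : ℚ))
    - (blueCount g n : ℚ) / n| ≤ ε

/-- An ε-biased `κ`-binning of the range `(l, h]`: boundaries
`l = b 0 < b 1 < ⋯ < b κ = h` such that every bucket `(b j, b (j+1)]`
is ε-biased. -/
def epsBiasedBinning (g : ℕ → Bool) (n : ℕ) (ε : ℚ) (l h κ : ℕ) : Prop :=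
  ∃ b : ℕ → ℕ, b 0 = l ∧ b κ = h ∧ (∀ j < κ, b j < b (j + 1)) ∧
    ∀ j < κ, epsBiasedBucket g n ε (b j) (b (j + 1))

theorem epsBiasedBucket_iff {g : ℕ → Bool} {n : ℕ} {ε : ℚ} {i j : ℕ} (hij : i < j) :
    epsBiasedBucket g n ε i j ↔
      |((blueCount g j : ℚ) - blueCount g i) - (blueCount g n : ℚ) / n * ((j : ℚ) - i)|
        ≤ ε * ((j : ℚ) - i) := by
  have hpos : (0 : ℚ) < (j : ℚ) - i := sub_pos.2 (by exact_mod_cast hij)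
  rw [epsBiasedBucket, ← mul_le_mul_iff_left₀ hpos]
  nth_rewrite 2 [← abs_of_pos hpos]
  rw [← abs_mul, sub_mul, div_mul_cancel₀ _ hpos.ne']

theorem epsBiasedBucket.trans {g : ℕ → Bool} {n : ℕ} {ε : ℚ} {i j k : ℕ}
    (hij : i < j) (hjk : j < k) (h₁ : epsBiasedBucket g n ε i j)
    (h₂ : epsBiasedBucket g n ε j k) : epsBiasedBucket g n ε i k := by
  rw [epsBiasedBucket_iff hij, abs_le] at h₁
  rw [epsBiasedBucket_iff hjk, abs_le] at h₂
  rw [epsBiasedBucket_iff (hij.trans hjk), abs_le]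
  constructor <;> linarith [h₁.1, h₁.2, h₂.1, h₂.2]

/-- The union of all buckets of a nonempty binning is a nonempty ε-biased bucket. -/
theorem epsBiasedBinning.lt_and_epsBiasedBucket {g : ℕ → Bool} {n : ℕ} {ε : ℚ} {l h κ : ℕ}
    (hκ : 1 ≤ κ) (hb : epsBiasedBinning g n ε l h κ) :
    l < h ∧ epsBiasedBucket g n ε l h := by
  obtain ⟨b, rfl, rfl, hlt, hbias⟩ := hb
  induction κ, hκ using Nat.le_induction with
  | base => exact ⟨hlt 0 one_pos, hbias 0 one_pos⟩
  | succ k hk ih =>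
    obtain ⟨h₁, h₂⟩ := ih (fun j hj => hlt j (by omega)) (fun j hj => hbias j (by omega))
    have h₃ := hlt k k.lt_succ_self
    exact ⟨h₁.trans h₃, h₂.trans h₁ h₃ (hbias k k.lt_succ_self)⟩

/-- A binning into `p + q` buckets splits after its first `p` buckets. -/
theorem epsBiasedBinning.exists_split {g : ℕ → Bool} {n : ℕ} {ε : ℚ} {l h p q : ℕ}
    (hb : epsBiasedBinning g n ε l h (p + q)) :
    ∃ i, epsBiasedBinning g n ε l i p ∧ epsBiasedBinning g n ε i h q := by
  obtain ⟨b, h0, hh, hlt, hbias⟩ := hb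
  exact ⟨b p, ⟨b, h0, rfl, fun j hj => hlt j (by omega), fun j hj => hbias j (by omega)⟩,
    fun j => b (p + j), rfl, hh, fun j hj => hlt (p + j) (by omega),
    fun j hj => hbias (p + j) (by omega)⟩

/-- Correctness of the divide-and-conquer split: if the range `(l, h]` admits an
ε-biased `κ`-binning (`κ ≥ 2`), then there is a split index `l < i < h` such
that both super buckets `(l, i]` and `(i, h]` are ε-biased, `(l, i]` admits an
ε-biased `⌈κ/2⌉`-binning, and `(i, h]` admits an ε-biased `⌊κ/2⌋`-binning. -/
theorem dnc_split_exists
    (n l h κ : ℕ) (g : ℕ → Bool) (ε : ℚ)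
    (hε : 0 ≤ ε) (hlh : l < h) (hhn : h ≤ n) (hκ : 2 ≤ κ)
    (hbin : epsBiasedBinning g n ε l h κ) :
    ∃ i, l < i ∧ i < h ∧
      epsBiasedBucket g n ε l i ∧ epsBiasedBucket g n ε i h ∧
      epsBiasedBinning g n ε l i ((κ + 1) / 2) ∧
      epsBiasedBinning g n ε i h (κ / 2) := by
  rw [show κ = (κ + 1) / 2 + κ / 2 by omega] at hbin
  obtain ⟨i, h₁, h₂⟩ := hbin.exists_split
  obtain ⟨hli, hbl⟩ := h₁.lt_and_epsBiasedBucket (by omega)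
  obtain ⟨hih, hbh⟩ := h₂.lt_and_epsBiasedBucket (by omega)
  exact ⟨i, hli, hih, hbl, hbh, h₁, h₂⟩
end
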